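/- For any agent a and any formulas χ, ψ of the language L, both □ₐ(□ₐχ→ψ) ↔ (□ₐχ→□ₐψ) and □ₐ(χ→□ₐψ) ↔ (◇ₐχ→□ₐψ) are S5G-valid. -/

import Mathlib

open scoped Classical

/-- Formulas of the language L over a set `A` of agents, with propositional
variables indexed by `ℕ`. -/
inductive Formula (A : Type) : Type
  | var : ℕ → Formula A
  | neg : Formula A → Formula A
  | and : Formula A → Formula A → Formula A
  | imp : Formula A → Formula A → Formula A
  | box : A → Formula A → Formula A

namespace Formula

/-- `◇ₐφ := ~□ₐ~φ`. -/
def dia {A : Type} (a : A) (φ : Formula A) : Formula A := .neg (.box a (.neg φ))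

/-- `φ ↔ χ := (φ→χ)∧(χ→φ)`. -/
def biImp {A : Type} (φ χ : Formula A) : Formula A := .and (.imp φ χ) (.imp χ φ)

/-- `𝟏 := p → p`. -/
def one {A : Type} : Formula A := .imp (.var 0) (.var 0)

/-- Coimplication `φ ⤙ χ := ~(~χ → ~φ)`. -/
def coimp {A : Type} (φ χ : Formula A) : Formula A := .neg (.imp (.neg χ) (.neg φ))

/-- Baaz Delta `△φ := 𝟏 ⤙ (𝟏 ⤙ φ)`. -/
def tri {A : Type} (φ : Formula A) : Formula A := coimp one (coimp one φ)

/-- `φ^△`: replace every occurrence of every propositional variable `p` by `△p`. -/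
def triSub {A : Type} : Formula A → Formula A
  | .var p => tri (.var p)
  | .neg φ => .neg φ.triSub
  | .and φ χ => .and φ.triSub χ.triSub
  | .imp φ χ => .imp φ.triSub χ.triSub
  | .box a φ => .box a φ.triSub

/-- `ℓ(φ)`: the number of occurrences of symbols in `φ`. -/
def size {A : Type} : Formula A → ℕ
  | .var _ => 1
  | .neg φ => φ.size + 1
  | .and φ χ => φ.size + χ.size + 1
  | .imp φ χ => φ.size + χ.size + 1
  | .box _ φ => φ.size + 1

/-- On every branch of the syntactic tree, the first modal operator encountered
(if any) is not `□ₐ`. -/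
def noUnguardedBox {A : Type} (a : A) : Formula A → Prop
  | .var _ => True
  | .neg φ => φ.noUnguardedBox a
  | .and φ χ => φ.noUnguardedBox a ∧ χ.noUnguardedBox a
  | .imp φ χ => φ.noUnguardedBox a ∧ χ.noUnguardedBox a
  | .box b _ => b ≠ a

/-- A formula is irredundantly nested if in every branch of its syntactic tree,
between any two nodes `□ₐ` there occurs a node `□_{a'}` for some `a' ≠ a`. -/
def IrredundantlyNested {A : Type} : Formula A → Prop
  | .var _ => True
  | .neg φ => φ.IrredundantlyNested
  | .and φ χ => φ.IrredundantlyNested ∧ χ.IrredundantlyNested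
  | .imp φ χ => φ.IrredundantlyNested ∧ χ.IrredundantlyNested
  | .box a φ => φ.noUnguardedBox a ∧ φ.IrredundantlyNested

/-- Auxiliary function for the modal alternation depth: the maximal alternation
number over leaves, where `o` records the agent of the nearest modal ancestor. -/
def aDepth {A : Type} [DecidableEq A] : Formula A → Option A → ℕ
  | .var _, _ => 0
  | .neg φ, o => φ.aDepth o
  | .and φ χ, o => max (φ.aDepth o) (χ.aDepth o)
  | .imp φ χ, o => max (φ.aDepth o) (χ.aDepth o)
  | .box a φ, o => if o = some a then φ.aDepth (some a) else φ.aDepth (some a) + 1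

/-- The modal alternation depth `𝒜(φ)`. -/
def altDepth {A : Type} [DecidableEq A] (φ : Formula A) : ℕ := φ.aDepth none

end Formula

/-- An S5G-model over agents `A` and states `W`: an epistemic frame (nonempty
`W`, each `R a` an equivalence relation) with a `[0,1]`-valued valuation. -/
structure S5GModel (A W : Type) where
  nonempty : Nonempty W
  R : A → W → W → Prop
  equiv : ∀ a, Equivalence (R a)
  val : ℕ → W → ℝ
  val_mem : ∀ p w, val p w ∈ Set.Icc (0 : ℝ) 1

/-- Gödel semantics on S5G-models. -/
noncomputable def S5GModel.v {A W : Type} (M : S5GModel A W) : Formula A → W → ℝ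
  | .var p, w => M.val p w
  | .neg φ, w => 1 - M.v φ w
  | .and φ χ, w => min (M.v φ w) (M.v χ w)
  | .imp φ χ, w => if M.v φ w ≤ M.v χ w then 1 else M.v χ w
  | .box a φ, w => sInf {x : ℝ | ∃ w', M.R a w w' ∧ M.v φ w' = x}

/-- S5G-validity: value `1` at every state of every S5G-model. -/
def S5GValid (A : Type) (φ : Formula A) : Prop :=
  ∀ (W : Type) (M : S5GModel A W) (w : W), M.v φ w = 1

/-- S5G-satisfiability: value `1` at some state of some S5G-model. -/
def S5GSat (A : Type) (φ : Formula A) : Prop :=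
  ∃ (W : Type) (M : S5GModel A W) (w : W), M.v φ w = 1

/-- An epistemic F-model (eF-model). -/
structure EFModel (A W : Type) where
  nonempty : Nonempty W
  R : A → W → W → Prop
  equiv : ∀ a, Equivalence (R a)
  T : A → W → Set ℝ
  T_finite : ∀ a w, (T a w).Finite
  T_sub : ∀ a w, T a w ⊆ Set.Icc (0 : ℝ) 1
  T_zero : ∀ a w, (0 : ℝ) ∈ T a w
  T_half : ∀ a w, (1 / 2 : ℝ) ∈ T a w
  T_one : ∀ a w, (1 : ℝ) ∈ T a w
  T_inv : ∀ a w x, x ∈ T a w → 1 - x ∈ T a w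
  T_R : ∀ a w w', R a w w' → T a w = T a w'
  val : ℕ → W → ℝ
  val_mem : ∀ p w, val p w ∈ Set.Icc (0 : ℝ) 1

/-- Semantics on eF-models: `v(□ₐφ,w)` is the greatest element of `T a w` below
`inf{v(φ,w') : w Rₐ w'}` (rendered via `sSup` of the relevant finite set). -/
noncomputable def EFModel.v {A W : Type} (M : EFModel A W) : Formula A → W → ℝ
  | .var p, w => M.val p w
  | .neg φ, w => 1 - M.v φ w
  | .and φ χ, w => min (M.v φ w) (M.v χ w)
  | .imp φ χ, w => if M.v φ w ≤ M.v χ w then 1 else M.v χ w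
  | .box a φ, w =>
      sSup {x : ℝ | x ∈ M.T a w ∧ x ≤ sInf {y : ℝ | ∃ w', M.R a w w' ∧ M.v φ w' = y}}

/-- eF-validity: value `1` at every state of every eF-model. -/
def EFValid (A : Type) (φ : Formula A) : Prop :=
  ∀ (W : Type) (M : EFModel A W) (w : W), M.v φ w = 1

theorem S5GModel.v_mem_Icc {A W : Type} (M : S5GModel A W) (φ : Formula A) (w : W) :
    M.v φ w ∈ Set.Icc (0 : ℝ) 1 := by
  induction φ generalizing w with
  | var p => exact M.val_mem p w
  | neg φ ih =>
    have h := ih w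
    simp only [S5GModel.v, Set.mem_Icc] at h ⊢
    constructor <;> linarith
  | and φ χ ih₁ ih₂ => exact ⟨le_min (ih₁ w).1 (ih₂ w).1, min_le_of_left_le (ih₁ w).2⟩
  | imp φ χ _ ih =>
    simp only [S5GModel.v]
    split_ifs
    · simp
    · exact ih w
  | box a φ ih =>
    have hnonneg : ∀ x ∈ {x : ℝ | ∃ w', M.R a w w' ∧ M.v φ w' = x}, 0 ≤ x := by
      rintro _ ⟨w', _, rfl⟩
      exact (ih w').1
    exact ⟨Real.sInf_nonneg hnonneg,
      (csInf_le ⟨0, hnonneg⟩ ⟨w, (M.equiv a).refl w, rfl⟩).trans (ih w).2⟩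

theorem S5GModel.le_v_box_iff {A W : Type} (M : S5GModel A W) {a : A} {φ : Formula A} {w : W}
    {r : ℝ} : r ≤ M.v (.box a φ) w ↔ ∀ w', M.R a w w' → r ≤ M.v φ w' := by
  have hbdd : BddBelow {x : ℝ | ∃ w', M.R a w w' ∧ M.v φ w' = x} := by
    refine ⟨0, ?_⟩
    rintro _ ⟨w', _, rfl⟩
    exact (M.v_mem_Icc φ w').1
  rw [S5GModel.v, le_csInf_iff hbdd ⟨_, w, (M.equiv a).refl w, rfl⟩]
  simp

theorem S5GModel.v_box_congr {A W : Type} (M : S5GModel A W) {a : A} (φ : Formula A) {w w' : W}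
    (h : M.R a w w') : M.v (.box a φ) w' = M.v (.box a φ) w := by
  refine eq_of_forall_le_iff fun r => ?_
  simp only [M.le_v_box_iff]
  exact ⟨fun H u hu => H u ((M.equiv a).trans ((M.equiv a).symm h) hu),
    fun H u hu => H u ((M.equiv a).trans h hu)⟩

theorem S5GModel.v_dia_le_iff {A W : Type} (M : S5GModel A W) {a : A} {φ : Formula A} {w : W}
    {r : ℝ} : M.v (.dia a φ) w ≤ r ↔ ∀ w', M.R a w w' → M.v φ w' ≤ r := by
  rw [Formula.dia, S5GModel.v, sub_le_comm, M.le_v_box_iff]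
  simp only [S5GModel.v, sub_le_sub_iff_left]

/-- Residuation for the Gödel implication. -/
theorem S5GModel.le_v_imp_iff {A W : Type} (M : S5GModel A W) {φ χ : Formula A} {w : W} {r : ℝ} :
    r ≤ M.v (.imp φ χ) w ↔ r ≤ 1 ∧ (r ≤ M.v χ w ∨ M.v φ w ≤ M.v χ w) := by
  have hχ := (M.v_mem_Icc χ w).2
  rw [S5GModel.v]
  split_ifs with h
  · simp [h]
  · simp only [h, or_false]
    exact ⟨fun hr => ⟨hr.trans hχ, hr⟩, And.right⟩

theorem S5GModel.v_biImp_of_eq {A W : Type} (M : S5GModel A W) {φ χ : Formula A} {w : W}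
    (h : M.v φ w = M.v χ w) : M.v (φ.biImp χ) w = 1 := by
  simp [Formula.biImp, S5GModel.v, h]

/-- `□ₐ(□ₐχ→ψ) ↔ (□ₐχ→□ₐψ)` and `□ₐ(χ→□ₐψ) ↔ (◇ₐχ→□ₐψ)` are
S5G-valid. -/
theorem stmt16 (A : Type) [Fintype A] [Nonempty A] (a : A) (χ ψ : Formula A) :
    S5GValid A ((Formula.box a (.imp (.box a χ) ψ)).biImp
      (.imp (Formula.box a χ) (Formula.box a ψ))) ∧
    S5GValid A ((Formula.box a (.imp χ (.box a ψ))).biImp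
      (.imp (Formula.dia a χ) (Formula.box a ψ))) := by
  constructor <;> intro W M w <;> refine M.v_biImp_of_eq (eq_of_forall_le_iff fun r => ?_)
  · have hw := (M.equiv a).refl w
    calc r ≤ M.v (.box a (.imp (.box a χ) ψ)) w
        ↔ ∀ w', M.R a w w' → r ≤ 1 ∧ min r (M.v (.box a χ) w) ≤ M.v ψ w' := by
          rw [M.le_v_box_iff]
          refine forall₂_congr fun w' h => ?_
          rw [M.le_v_imp_iff, M.v_box_congr χ h, min_le_iff]
      _ ↔ r ≤ 1 ∧ min r (M.v (.box a χ) w) ≤ M.v (.box a ψ) w := by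
          rw [M.le_v_box_iff]
          exact ⟨fun H => ⟨(H w hw).1, fun w' h => (H w' h).2⟩, fun H w' h => ⟨H.1, H.2 w' h⟩⟩
      _ ↔ r ≤ M.v (.imp (.box a χ) (.box a ψ)) w := by
          rw [M.le_v_imp_iff, min_le_iff]
  · have hw := (M.equiv a).refl w
    calc r ≤ M.v (.box a (.imp χ (.box a ψ))) w
        ↔ ∀ w', M.R a w w' → r ≤ 1 ∧ (r ≤ M.v (.box a ψ) w ∨ M.v χ w' ≤ M.v (.box a ψ) w) := by
          rw [M.le_v_box_iff]
          refine forall₂_congr fun w' h => ?_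
          rw [M.le_v_imp_iff, M.v_box_congr ψ h]
      _ ↔ r ≤ 1 ∧ (r ≤ M.v (.box a ψ) w ∨ ∀ w', M.R a w w' → M.v χ w' ≤ M.v (.box a ψ) w) := by
          simp only [← forall_or_left]
          exact ⟨fun H => ⟨(H w hw).1, fun w' h => (H w' h).2⟩, fun H w' h => ⟨H.1, H.2 w' h⟩⟩
      _ ↔ r ≤ M.v (.imp (.dia a χ) (.box a ψ)) w := by
          rw [M.le_v_imp_iff, M.v_dia_le_iff]
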